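/- (Main theorem, part (a): every local minimum is global.) Let n, d, N be positive naturals with d ≤ n, and for i = 1, …, N let M_i be a real n×d matrix with rank M_i = d. Define the objective F(V, σ) = Σ_{i=1}^N log( Σ_{j=1}^d ‖c_{ij}(V_i)‖² σ_{ij}² ), where c_{ij}(V_i) is the j-th column of M_i V_iᵀ, over d×d orthogonal matrices V_i and positive reals σ_{ij} subject to the constraint Σ_{i,j} (−log σ_{ij}²) = C. If a feasible point (V, σ) satisfies F(V, σ) > N·log d − C/d + (1/d) Σ_i log det(M_iᵀ M_i) (i.e. it is not a global minimum), then for every ε > 0 there exists a feasible point (V', σ') with ‖V'_i − V_i‖ < ε and |σ'_{ij} − σ_{ij}| < ε for all i, j, such that F(V', σ') < F(V, σ). Hence the constrained problem has no local minima other than global minima. -/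

import Mathlib

open Matrix

/-- The objective `F(V, σ) = ∑_i log (∑_j ‖c_{ij}(V_i)‖² σ_{ij}²)`, where `c_{ij}(V_i)` is
the `j`-th column of `M_i V_iᵀ` (Euclidean norms of columns). -/
noncomputable def vaeObjective {n d N : ℕ} (M : Fin N → Matrix (Fin n) (Fin d) ℝ)
    (V : Fin N → Matrix (Fin d) (Fin d) ℝ) (σ : Fin N → Fin d → ℝ) : ℝ :=
  ∑ i, Real.log (∑ j,
    ‖(WithLp.equiv 2 (Fin n → ℝ)).symm (fun r => (M i * (V i)ᵀ) r j)‖ ^ 2 * (σ i j) ^ 2)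

open Filter Topology

section

lemma sum_sub_sum_of_eq_off_pair {ι : Type*} [Fintype ι] {f g : ι → ℝ} {j k : ι} (hjk : j ≠ k)
    (h : ∀ p, p ≠ j → p ≠ k → g p = f p) :
    ∑ p, g p - ∑ p, f p = (g j - f j) + (g k - f k) := by
  classical
  rw [← Finset.sum_sub_distrib]
  exact Fintype.sum_eq_add j k hjk fun p hp => by rw [h p hp.1 hp.2, sub_self]

/-- The squared Euclidean norm of the `j`-th column. -/
def colSq {ι ρ : Type*} [Fintype ρ] (G : Matrix ρ ι ℝ) (j : ι) : ℝ := ∑ r, G r j ^ 2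

lemma colSq_eq_diag {ι ρ : Type*} [Fintype ρ] (G : Matrix ρ ι ℝ) (j : ι) :
    colSq G j = (Gᵀ * G) j j := by
  simp [colSq, Matrix.mul_apply, sq]

variable {ι κ : Type*} [DecidableEq ι]

/-- Rotation of rows `j` and `k` of a matrix by the angle with cosine `c` and sine `s`. -/
def rotateRows (V : Matrix ι κ ℝ) (j k : ι) (c s : ℝ) : Matrix ι κ ℝ :=
  Matrix.of fun p a =>
    if p = j then c * V j a + s * V k a else if p = k then -s * V j a + c * V k a else V p a

variable (V : Matrix ι κ ℝ) {j k : ι} (c s : ℝ)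

lemma rotateRows_left (a : κ) : rotateRows V j k c s j a = c * V j a + s * V k a := by
  simp [rotateRows]

lemma rotateRows_right (hjk : j ≠ k) (a : κ) :
    rotateRows V j k c s k a = -s * V j a + c * V k a := by
  simp [rotateRows, hjk.symm]

lemma rotateRows_of_ne {p : ι} (h1 : p ≠ j) (h2 : p ≠ k) (a : κ) :
    rotateRows V j k c s p a = V p a := by
  simp [rotateRows, h1, h2]

lemma rotateRows_transpose_mul_self [Fintype ι] (hjk : j ≠ k) {c s : ℝ} (hcs : c ^ 2 + s ^ 2 = 1) :
    (rotateRows V j k c s)ᵀ * rotateRows V j k c s = Vᵀ * V := by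
  ext a b
  simp only [Matrix.mul_apply, Matrix.transpose_apply]
  rw [← sub_eq_zero, sum_sub_sum_of_eq_off_pair hjk fun p e1 e2 => by
    rw [rotateRows_of_ne V c s e1 e2, rotateRows_of_ne V c s e1 e2]]
  simp only [rotateRows_left, rotateRows_right V c s hjk]
  linear_combination (V j a * V j b + V k a * V k b) * hcs

lemma mul_rotateRows_transpose [Fintype κ] {ρ : Type*} (M : Matrix ρ κ ℝ) (hjk : j ≠ k) :
    M * (rotateRows V j k c s)ᵀ = (rotateRows (M * Vᵀ)ᵀ j k c s)ᵀ := by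
  ext r p
  simp only [Matrix.mul_apply, Matrix.transpose_apply]
  by_cases e1 : p = j
  · subst e1
    simp only [rotateRows_left, Matrix.transpose_apply, Matrix.mul_apply, Finset.mul_sum,
      ← Finset.sum_add_distrib]
    exact Finset.sum_congr rfl fun _ _ => by ring
  by_cases e2 : p = k
  · subst e2
    simp only [rotateRows_right _ c s hjk, Matrix.transpose_apply, Matrix.mul_apply,
      Finset.mul_sum, ← Finset.sum_add_distrib]
    exact Finset.sum_congr rfl fun _ _ => by ring
  · simp only [rotateRows_of_ne _ c s e1 e2, Matrix.transpose_apply, Matrix.mul_apply]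

lemma colSq_pos [Fintype ι] {ρ : Type*} [Fintype ρ] {G : Matrix ρ ι ℝ}
    (h : (Gᵀ * G).det ≠ 0) (j : ι) :
    0 < colSq G j := by
  refine (Finset.sum_nonneg fun r _ => sq_nonneg _).lt_of_ne' fun h0 => h ?_
  rw [Finset.sum_eq_zero_iff_of_nonneg fun r _ => sq_nonneg _] at h0
  refine Matrix.det_eq_zero_of_column_eq_zero j fun p => ?_
  rw [Matrix.mul_apply]
  exact Finset.sum_eq_zero fun r hr => by rw [pow_eq_zero_iff two_ne_zero |>.mp (h0 r hr), mul_zero]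

lemma colSq_rotateRows {ρ : Type*} [Fintype ρ] (G : Matrix ρ ι ℝ) (hjk : j ≠ k) {c s : ℝ}
    (hcs : c ^ 2 + s ^ 2 = 1) :
    colSq (rotateRows Gᵀ j k c s)ᵀ j
        = colSq G j + (2 * c * s * (Gᵀ * G) j k - s ^ 2 * (colSq G j - colSq G k)) ∧
      colSq (rotateRows Gᵀ j k c s)ᵀ k
        = colSq G k - (2 * c * s * (Gᵀ * G) j k - s ^ 2 * (colSq G j - colSq G k)) ∧
      ∀ p, p ≠ j → p ≠ k → colSq (rotateRows Gᵀ j k c s)ᵀ p = colSq G p := by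
  refine ⟨?_, ?_, fun p e1 e2 => ?_⟩
  · simp only [colSq, Matrix.transpose_apply, rotateRows_left, Matrix.mul_apply, mul_sub,
      Finset.mul_sum, ← Finset.sum_add_distrib, ← Finset.sum_sub_distrib]
    exact Finset.sum_congr rfl fun r _ => by linear_combination G r j ^ 2 * hcs
  · simp only [colSq, Matrix.transpose_apply, rotateRows_right _ c s hjk, Matrix.mul_apply,
      mul_sub, Finset.mul_sum, ← Finset.sum_sub_distrib]
    exact Finset.sum_congr rfl fun r _ => by linear_combination G r k ^ 2 * hcs
  · simp only [colSq, Matrix.transpose_apply, rotateRows_of_ne _ c s e1 e2]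

/-- When the `j`-th and `k`-th columns of `M * Vᵀ` are not orthogonal, an arbitrarily small rotation
of `V` strictly changes their norms, without bringing them closer to each other. -/
lemma exists_rotation [Fintype ι] [Fintype κ] {ρ : Type*} [Fintype ρ] (M : Matrix ρ κ ℝ) (hjk : j ≠ k)
    (hb : ((M * Vᵀ)ᵀ * (M * Vᵀ)) j k ≠ 0) {ε : ℝ} (hε : 0 < ε) :
    ∃ (W : Matrix ι κ ℝ) (δ : ℝ), Wᵀ * W = Vᵀ * V ∧
      Real.sqrt (∑ r, ∑ a, (W r a - V r a) ^ 2) < ε ∧ δ ≠ 0 ∧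
      0 ≤ δ * (colSq (M * Vᵀ) j - colSq (M * Vᵀ) k) ∧
      colSq (M * Wᵀ) j = colSq (M * Vᵀ) j + δ ∧
      colSq (M * Wᵀ) k = colSq (M * Vᵀ) k - δ ∧
      ∀ p, p ≠ j → p ≠ k → colSq (M * Wᵀ) p = colSq (M * Vᵀ) p := by
  set G := M * Vᵀ
  set b := (Gᵀ * G) j k
  set D := colSq G j - colSq G k
  obtain ⟨q, hq0, hq⟩ : ∃ q : ℝ, q ≠ 0 ∧ (D ≠ 0 → q = b * D) := by
    by_cases h : D = 0
    · exact ⟨1, one_ne_zero, fun h' => absurd h h'⟩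
    · exact ⟨b * D, mul_ne_zero hb h, fun _ => rfl⟩
  have ev1 : ∀ᶠ t in 𝓝[>] (0 : ℝ), 1 / 2 < Real.sqrt (1 - (t * q) ^ 2) := by
    have : Tendsto (fun t : ℝ => Real.sqrt (1 - (t * q) ^ 2)) (𝓝 0) (𝓝 1) :=
      Continuous.tendsto' (by fun_prop) _ _ (by simp)
    exact (this.mono_left nhdsWithin_le_nhds).eventually_const_lt (by norm_num)
  have ev2 : ∀ᶠ t in 𝓝[>] (0 : ℝ), t * D ^ 2 < 1 := by
    have : Tendsto (fun t : ℝ => t * D ^ 2) (𝓝 0) (𝓝 0) :=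
      Continuous.tendsto' (by fun_prop) _ _ (by simp)
    exact (this.mono_left nhdsWithin_le_nhds).eventually_lt_const one_pos
  have ev3 : ∀ᶠ t in 𝓝[>] (0 : ℝ), Real.sqrt (∑ r, ∑ a,
      (rotateRows V j k (Real.sqrt (1 - (t * q) ^ 2)) (t * q) r a - V r a) ^ 2) < ε := by
    have : Tendsto (fun t : ℝ => Real.sqrt (∑ r, ∑ a,
        (rotateRows V j k (Real.sqrt (1 - (t * q) ^ 2)) (t * q) r a - V r a) ^ 2))
        (𝓝 0) (𝓝 0) := by
      refine Continuous.tendsto' ?_ _ _ ?_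
      · refine Real.continuous_sqrt.comp <| continuous_finsetSum _ fun r _ =>
          continuous_finsetSum _ fun a _ => ?_
        simp only [rotateRows, Matrix.of_apply]
        split_ifs <;> fun_prop
      · rw [Real.sqrt_eq_zero']
        refine (Finset.sum_eq_zero fun r _ => Finset.sum_eq_zero fun a _ => ?_).le
        simp only [rotateRows, Matrix.of_apply]
        split_ifs <;> simp_all
    exact (this.mono_left nhdsWithin_le_nhds).eventually_lt_const hε
  obtain ⟨t, h1, h2, h3, ht⟩ := (ev1.and (ev2.and (ev3.and self_mem_nhdsWithin))).exists
  have ht0 : 0 < t := ht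
  set s := t * q with hs
  set c := Real.sqrt (1 - s ^ 2) with hc
  have hcs : c ^ 2 + s ^ 2 = 1 := by
    have : 0 < 1 - s ^ 2 := Real.sqrt_pos.mp (by linarith)
    rw [hc, Real.sq_sqrt this.le]
    ring
  have key : D ≠ 0 → 0 < (2 * c * s * b - s ^ 2 * D) * D := by
    intro hD0
    have e : (2 * c * s * b - s ^ 2 * D) * D = t * (b * D) ^ 2 * (2 * c - t * D ^ 2) := by
      rw [hs, hq hD0]; ring
    rw [e]
    have : 0 < 2 * c - t * D ^ 2 := by linarith
    have : b * D ≠ 0 := mul_ne_zero hb hD0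
    positivity
  obtain ⟨r1, r2, r3⟩ := colSq_rotateRows G hjk hcs
  refine ⟨rotateRows V j k c s, 2 * c * s * b - s ^ 2 * D,
    rotateRows_transpose_mul_self V hjk hcs, h3, ?_, ?_, ?_⟩
  · by_cases hD0 : D = 0
    · rw [hD0, mul_zero, sub_zero]
      have : c ≠ 0 := by linarith
      have : s ≠ 0 := mul_ne_zero ht0.ne' hq0
      positivity
    · intro h0
      have := key hD0
      rw [h0, zero_mul] at this
      exact lt_irrefl _ this
  · by_cases hD0 : D = 0
    · rw [hD0, mul_zero]
    · exact (key hD0).le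
  · rw [mul_rotateRows_transpose V c s M hjk]
    exact ⟨r1, r2, r3⟩

/-- If two weighted terms differ, a small rescaling of the two weights preserving their product
decreases the weighted sum. -/
lemma exists_rescale_sum_lt [Fintype ι] {x σ : ι → ℝ} (hσ : ∀ j, 0 < σ j) {j k : ι}
    (hxj : 0 < x j) (h : x j * σ j ^ 2 < x k * σ k ^ 2) {ε : ℝ} (hε : 0 < ε) :
    ∃ τ : ι → ℝ, (∀ p, 0 < τ p) ∧
      ∑ p, -Real.log (τ p ^ 2) = ∑ p, -Real.log (σ p ^ 2) ∧
      (∀ p, |τ p - σ p| < ε) ∧ ∑ p, x p * τ p ^ 2 < ∑ p, x p * σ p ^ 2 := by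
  have hjk : j ≠ k := by rintro rfl; exact lt_irrefl _ h
  have hwj : 0 < x j * σ j ^ 2 := mul_pos hxj (pow_pos (hσ j) 2)
  have ev1 : ∀ᶠ t in 𝓝[>] (1 : ℝ), |σ j * t - σ j| < ε := by
    have : Tendsto (fun t : ℝ => |σ j * t - σ j|) (𝓝 1) (𝓝 0) :=
      Continuous.tendsto' (by fun_prop) _ _ (by simp)
    exact (this.mono_left nhdsWithin_le_nhds).eventually_lt_const hε
  have ev2 : ∀ᶠ t in 𝓝[>] (1 : ℝ), |σ k / t - σ k| < ε := by
    have : ContinuousAt (fun t : ℝ => |σ k / t - σ k|) 1 := by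
      fun_prop (disch := norm_num)
    have this : Tendsto (fun t : ℝ => |σ k / t - σ k|) (𝓝 1) (𝓝 0) := by
      simpa using this.tendsto
    exact (this.mono_left nhdsWithin_le_nhds).eventually_lt_const hε
  have ev3 : ∀ᶠ t in 𝓝[>] (1 : ℝ), (x j * σ j ^ 2) * t ^ 2 < x k * σ k ^ 2 := by
    have : Tendsto (fun t : ℝ => (x j * σ j ^ 2) * t ^ 2) (𝓝 1) (𝓝 (x j * σ j ^ 2)) :=
      Continuous.tendsto' (by fun_prop) _ _ (by simp)
    exact (this.mono_left nhdsWithin_le_nhds).eventually_lt_const h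
  obtain ⟨t, h1, h2, h3, ht⟩ := (ev1.and (ev2.and (ev3.and self_mem_nhdsWithin))).exists
  have ht1 : 1 < t := ht
  have ht0 : 0 < t := by linarith
  set τ : ι → ℝ := fun p => if p = j then σ j * t else if p = k then σ k / t else σ p with hτ
  have τj : τ j = σ j * t := by simp [hτ]
  have τk : τ k = σ k / t := by simp [hτ, hjk.symm]
  have τp : ∀ p, p ≠ j → p ≠ k → τ p = σ p := fun p h1 h2 => by simp [hτ, h1, h2]
  have cases_pair : ∀ P : ι → Prop, P j → P k → (∀ p, p ≠ j → p ≠ k → P p) → ∀ p, P p := by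
    intro P hj hk hp p
    by_cases e1 : p = j
    · exact e1 ▸ hj
    by_cases e2 : p = k
    · exact e2 ▸ hk
    exact hp p e1 e2
  refine ⟨τ, cases_pair _ ?_ ?_ ?_, ?_, cases_pair _ ?_ ?_ ?_, ?_⟩
  · rw [τj]; exact mul_pos (hσ j) ht0
  · rw [τk]; exact div_pos (hσ k) ht0
  · intro p e1 e2; rw [τp p e1 e2]; exact hσ p
  · rw [← sub_eq_zero, sum_sub_sum_of_eq_off_pair hjk fun p e1 e2 => by rw [τp p e1 e2], τj, τk,
      Real.log_pow, Real.log_pow, Real.log_pow, Real.log_pow,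
      Real.log_mul (hσ j).ne' ht0.ne', Real.log_div (hσ k).ne' ht0.ne']
    ring
  · rwa [τj]
  · rwa [τk]
  · intro p e1 e2; rw [τp p e1 e2]; simpa using hε
  · rw [← sub_neg, sum_sub_sum_of_eq_off_pair hjk fun p e1 e2 => by rw [τp p e1 e2], τj, τk]
    have : x j * (σ j * t) ^ 2 - x j * σ j ^ 2 + (x k * (σ k / t) ^ 2 - x k * σ k ^ 2)
        = (t ^ 2 - 1) * ((x j * σ j ^ 2) * t ^ 2 - x k * σ k ^ 2) / t ^ 2 := by
      field_simp
      ring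
    rw [this]
    refine div_neg_of_neg_of_pos (mul_neg_of_pos_of_neg ?_ ?_) (by positivity)
    · nlinarith
    · linarith

end

lemma vaeObjective_eq {n d N : ℕ} (M : Fin N → Matrix (Fin n) (Fin d) ℝ)
    (V : Fin N → Matrix (Fin d) (Fin d) ℝ) (σ : Fin N → Fin d → ℝ) :
    vaeObjective M V σ = ∑ i, Real.log (∑ j, colSq (M i * (V i)ᵀ) j * σ i j ^ 2) := by
  simp [vaeObjective, colSq, EuclideanSpace.norm_sq_eq]

lemma vaeObjective_lt_of_row {n d N : ℕ} {M : Fin N → Matrix (Fin n) (Fin d) ℝ}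
    {V V' : Fin N → Matrix (Fin d) (Fin d) ℝ} {σ σ' : Fin N → Fin d → ℝ} {i : Fin N}
    (hV : ∀ l, l ≠ i → V' l = V l) (hσ : ∀ l, l ≠ i → σ' l = σ l)
    (hpos : 0 < ∑ j, colSq (M i * (V' i)ᵀ) j * σ' i j ^ 2)
    (h : ∑ j, colSq (M i * (V' i)ᵀ) j * σ' i j ^ 2 < ∑ j, colSq (M i * (V i)ᵀ) j * σ i j ^ 2) :
    vaeObjective M V' σ' < vaeObjective M V σ := by
  rw [vaeObjective_eq, vaeObjective_eq]
  have hi := Real.log_lt_log hpos h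
  refine Finset.sum_lt_sum (fun l _ => ?_) ⟨i, Finset.mem_univ i, hi⟩
  rcases eq_or_ne l i with rfl | hl
  · exact hi.le
  · rw [hV l hl, hσ l hl]

lemma det_transpose_mul_orthogonal {n d : ℕ} (M : Matrix (Fin n) (Fin d) ℝ)
    {V : Matrix (Fin d) (Fin d) ℝ} (hV : Vᵀ * V = 1) :
    ((M * Vᵀ)ᵀ * (M * Vᵀ)).det = (Mᵀ * M).det := by
  have h : V.det * V.det = 1 := by
    simpa using congrArg Matrix.det hV
  rw [Matrix.transpose_mul, Matrix.transpose_transpose, Matrix.mul_assoc, ← Matrix.mul_assoc Mᵀ,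
    Matrix.det_mul, Matrix.det_mul, Matrix.det_transpose]
  linear_combination (Mᵀ * M).det * h

lemma det_transpose_mul_self_ne_zero {n d : ℕ} {M : Matrix (Fin n) (Fin d) ℝ} (h : M.rank = d) :
    (Mᵀ * M).det ≠ 0 := by
  rw [← isUnit_iff_ne_zero, ← Matrix.isUnit_iff_isUnit_det]
  rw [← Matrix.rank_transpose_mul_self] at h
  rw [← Matrix.mulVec_surjective_iff_isUnit, ← Matrix.coe_mulVecLin, ← LinearMap.range_eq_top]
  exact Submodule.eq_top_of_finrank_eq (by rw [Module.finrank_fin_fun]; exact h)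

/-- If all weighted column norms within each row agree and the columns of each `M i * (V i)ᵀ` are
orthogonal, then the objective attains the lower bound. -/
lemma vaeObjective_eq_of_balanced {n d N : ℕ} (hd : 0 < d) {M : Fin N → Matrix (Fin n) (Fin d) ℝ}
    (hrank : ∀ i, (M i).rank = d) {V : Fin N → Matrix (Fin d) (Fin d) ℝ}
    (hV : ∀ i, (V i)ᵀ * V i = 1) {σ : Fin N → Fin d → ℝ} (hσ : ∀ i j, 0 < σ i j)
    (hbal : ∀ i j k, colSq (M i * (V i)ᵀ) j * σ i j ^ 2 = colSq (M i * (V i)ᵀ) k * σ i k ^ 2)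
    (hdiag : ∀ i j k, j ≠ k → ((M i * (V i)ᵀ)ᵀ * (M i * (V i)ᵀ)) j k = 0) :
    vaeObjective M V σ = (N : ℝ) * Real.log d - (∑ i, ∑ j, -Real.log (σ i j ^ 2)) / d +
      (1 / d : ℝ) * ∑ i, Real.log ((M i)ᵀ * M i).det := by
  have hd' : (d : ℝ) ≠ 0 := by positivity
  have row : ∀ i, Real.log (∑ j, colSq (M i * (V i)ᵀ) j * σ i j ^ 2) =
      Real.log d - (∑ j, -Real.log (σ i j ^ 2)) / d + (1 / d : ℝ) * Real.log ((M i)ᵀ * M i).det := by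
    intro i
    set x := colSq (M i * (V i)ᵀ) with hx
    have hdet := det_transpose_mul_orthogonal (M i) (hV i)
    have hxpos : ∀ j, 0 < x j :=
      colSq_pos (hdet ▸ det_transpose_mul_self_ne_zero (hrank i))
    have hprod : ((M i)ᵀ * M i).det = ∏ j, x j := by
      have e : (M i * (V i)ᵀ)ᵀ * (M i * (V i)ᵀ) = Matrix.diagonal x := by
        ext j k
        rcases eq_or_ne j k with rfl | hjk
        · rw [Matrix.diagonal_apply_eq, hx, colSq_eq_diag]
        · rw [Matrix.diagonal_apply_ne _ hjk, hdiag i j k hjk]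
      rw [← hdet, e, Matrix.det_diagonal]
    set w := x ⟨0, hd⟩ * σ i ⟨0, hd⟩ ^ 2
    have hwj : ∀ j, x j * σ i j ^ 2 = w := fun j => hbal i j _
    have hwpos : 0 < w := mul_pos (hxpos _) (pow_pos (hσ _ _) 2)
    have hlog : ∀ j, Real.log (x j) + Real.log (σ i j ^ 2) = Real.log w := fun j => by
      rw [← hwj j, Real.log_mul (hxpos j).ne' (pow_pos (hσ i j) 2).ne']
    have hsum : ∑ j, Real.log (x j) + ∑ j, Real.log (σ i j ^ 2) = d * Real.log w := by
      rw [← Finset.sum_add_distrib, Finset.sum_congr rfl fun j _ => hlog j]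
      simp
    rw [Finset.sum_congr rfl fun j _ => hwj j, hprod, Real.log_prod fun j _ => (hxpos j).ne',
      Finset.sum_const, Finset.card_univ, Fintype.card_fin, nsmul_eq_mul,
      Real.log_mul hd' hwpos.ne', Finset.sum_neg_distrib]
    field_simp
    linarith
  rw [vaeObjective_eq, Finset.sum_congr rfl fun i _ => row i, Finset.sum_add_distrib,
    Finset.sum_sub_distrib, ← Finset.mul_sum, ← Finset.sum_div]
  simp

lemma exists_improvement_of_unbalanced {n d N : ℕ} {M : Fin N → Matrix (Fin n) (Fin d) ℝ}
    (hrank : ∀ i, (M i).rank = d) {V : Fin N → Matrix (Fin d) (Fin d) ℝ}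
    (hV : ∀ i, (V i)ᵀ * V i = 1) {σ : Fin N → Fin d → ℝ} (hσ : ∀ i j, 0 < σ i j)
    {i : Fin N} {j k : Fin d}
    (h : colSq (M i * (V i)ᵀ) j * σ i j ^ 2 ≠ colSq (M i * (V i)ᵀ) k * σ i k ^ 2)
    {ε : ℝ} (hε : 0 < ε) :
    ∃ σ' : Fin N → Fin d → ℝ, (∀ i j, 0 < σ' i j) ∧
      ∑ i, ∑ j, -Real.log (σ' i j ^ 2) = ∑ i, ∑ j, -Real.log (σ i j ^ 2) ∧
      (∀ i j, |σ' i j - σ i j| < ε) ∧ vaeObjective M V σ' < vaeObjective M V σ := by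
  have hx : ∀ j, 0 < colSq (M i * (V i)ᵀ) j :=
    colSq_pos (det_transpose_mul_orthogonal (M i) (hV i) ▸ det_transpose_mul_self_ne_zero (hrank i))
  wlog hlt : colSq (M i * (V i)ᵀ) j * σ i j ^ 2 < colSq (M i * (V i)ᵀ) k * σ i k ^ 2
      generalizing j k
  · exact this h.symm (h.lt_or_gt.resolve_left hlt)
  obtain ⟨τ, t1, t2, t3, t4⟩ := exists_rescale_sum_lt (hσ i) (hx j) hlt hε
  have hne : ∀ l, l ≠ i → Function.update σ i τ l = σ l := fun l hl =>
    Function.update_of_ne hl _ _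
  refine ⟨Function.update σ i τ, fun l => ?_, Finset.sum_congr rfl fun l _ => ?_, fun l => ?_, ?_⟩
  · rcases eq_or_ne l i with rfl | hl
    · simpa using t1
    · rw [hne l hl]; exact hσ l
  · rcases eq_or_ne l i with rfl | hl
    · simpa using t2
    · rw [hne l hl]
  · rcases eq_or_ne l i with rfl | hl
    · simpa using t3
    · rw [hne l hl]; simpa using fun _ => hε
  · refine vaeObjective_lt_of_row (i := i) (fun _ _ => rfl) hne ?_ (by simpa using t4)
    exact Finset.sum_pos (fun p _ => mul_pos (hx p) (by simpa using pow_pos (t1 p) 2))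
      ⟨j, Finset.mem_univ j⟩

/-- **Main theorem, part (a): every local minimum is global.** If a feasible point `(V, σ)`
of the constrained problem is not a global minimum (its objective value exceeds the global
lower bound), then arbitrarily close to it (in Frobenius distance on the `V_i` and entrywise
on the `σ_{ij}`) there is a feasible point with strictly smaller objective value; hence the
constrained problem has no non-global local minima. -/
theorem vae_no_nonglobal_local_minima
    (n d N : ℕ) (hn : 0 < n) (hd : 0 < d) (hN : 0 < N) (hdn : d ≤ n)
    (M : Fin N → Matrix (Fin n) (Fin d) ℝ) (hrank : ∀ i, (M i).rank = d)
    (C : ℝ)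
    (V : Fin N → Matrix (Fin d) (Fin d) ℝ) (hV : ∀ i, (V i)ᵀ * V i = 1)
    (σ : Fin N → Fin d → ℝ) (hσ : ∀ i j, 0 < σ i j)
    (hC : (∑ i, ∑ j, (-Real.log ((σ i j) ^ 2))) = C)
    (hnotmin : vaeObjective M V σ >
      (N : ℝ) * Real.log d - C / d +
        (1 / d : ℝ) * ∑ i, Real.log ((M i)ᵀ * M i).det) :
    ∀ ε > (0 : ℝ),
      ∃ (V' : Fin N → Matrix (Fin d) (Fin d) ℝ) (σ' : Fin N → Fin d → ℝ),
        (∀ i, (V' i)ᵀ * V' i = 1) ∧ (∀ i j, 0 < σ' i j) ∧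
        (∑ i, ∑ j, (-Real.log ((σ' i j) ^ 2))) = C ∧
        (∀ i, Real.sqrt (∑ r, ∑ c, (V' i r c - V i r c) ^ 2) < ε) ∧
        (∀ i j, |σ' i j - σ i j| < ε) ∧
        vaeObjective M V' σ' < vaeObjective M V σ := by
  intro ε hε
  by_cases hbal : ∀ i j k,
      colSq (M i * (V i)ᵀ) j * σ i j ^ 2 = colSq (M i * (V i)ᵀ) k * σ i k ^ 2
  swap
  · push Not at hbal
    obtain ⟨i, j, k, hne⟩ := hbal
    obtain ⟨σ', s1, s2, s3, s4⟩ := exists_improvement_of_unbalanced hrank hV hσ hne hε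
    exact ⟨V, σ', hV, s1, s2.trans hC, fun i => by simpa using hε, s3, s4⟩
  by_cases hdiag : ∀ i j k, j ≠ k → ((M i * (V i)ᵀ)ᵀ * (M i * (V i)ᵀ)) j k = 0
  · have := vaeObjective_eq_of_balanced hd hrank hV hσ hbal hdiag
    rw [hC] at this
    exact absurd this hnotmin.ne'
  push Not at hdiag
  obtain ⟨i, j, k, hjk, hb⟩ := hdiag
  obtain ⟨W, δ, w1, w2, hδ, hδD, xj, xk, xp⟩ := exists_rotation (V i) (M i) hjk hb hε
  set V' := Function.update V i W
  have hVi : V' i = W := Function.update_self _ _ _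
  have hne : ∀ l, l ≠ i → V' l = V l := fun l hl => Function.update_of_ne hl _ _
  have horth : ∀ l, (V' l)ᵀ * V' l = 1 := fun l => by
    rcases eq_or_ne l i with rfl | hl
    · rw [hVi, w1, hV]
    · rw [hne l hl, hV]
  have hclose : ∀ l, Real.sqrt (∑ r, ∑ c, (V' l r c - V l r c) ^ 2) < ε := fun l => by
    rcases eq_or_ne l i with rfl | hl
    · rw [hVi]; exact w2
    · rw [hne l hl]; simpa using hε
  have hx : ∀ p, 0 < colSq (M i * (V i)ᵀ) p :=
    colSq_pos (det_transpose_mul_orthogonal (M i) (hV i) ▸ det_transpose_mul_self_ne_zero (hrank i))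
  have hx' : ∀ p, 0 < colSq (M i * Wᵀ) p :=
    colSq_pos (det_transpose_mul_orthogonal (M i) (hVi ▸ horth i) ▸
      det_transpose_mul_self_ne_zero (hrank i))
  have hjk_bal := hbal i j k
  set y := colSq (M i * Wᵀ)
  set x := colSq (M i * (V i)ᵀ)
  have hσj := pow_pos (hσ i j) 2
  have hσk := pow_pos (hσ i k) 2
  have hdiff : ∑ p, y p * σ i p ^ 2 - ∑ p, x p * σ i p ^ 2 = δ * (σ i j ^ 2 - σ i k ^ 2) := by
    rw [sum_sub_sum_of_eq_off_pair hjk fun p e1 e2 => by rw [xp p e1 e2], xj, xk]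
    ring
  have hneg : x k * (δ * (σ i j ^ 2 - σ i k ^ 2)) = -(σ i j ^ 2 * (δ * (x j - x k))) := by
    linear_combination δ * hjk_bal
  rcases eq_or_ne (x j) (x k) with hD | hD
  · have hσeq : σ i j ^ 2 = σ i k ^ 2 := by
      rw [hD] at hjk_bal
      exact mul_left_cancel₀ (hx k).ne' hjk_bal
    have hunb : colSq (M i * (V' i)ᵀ) j * σ i j ^ 2 ≠ colSq (M i * (V' i)ᵀ) k * σ i k ^ 2 := by
      rw [hVi]
      change y j * _ ≠ y k * _
      rw [xj, xk, hσeq, hD]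
      intro h
      have := mul_right_cancel₀ hσk.ne' h
      exact hδ (by linarith)
    obtain ⟨σ', s1, s2, s3, s4⟩ := exists_improvement_of_unbalanced hrank horth hσ hunb hε
    refine ⟨V', σ', horth, s1, s2.trans hC, hclose, s3, s4.trans_eq ?_⟩
    rw [vaeObjective_eq, vaeObjective_eq]
    refine Finset.sum_congr rfl fun l _ => ?_
    rcases eq_or_ne l i with rfl | hl
    · rw [hVi]
      congr 1
      rw [hσeq, sub_self, mul_zero, sub_eq_zero] at hdiff
      exact hdiff
    · rw [hne l hl]
  · refine ⟨V', σ, horth, hσ, hC, hclose, fun _ _ => by simpa using hε,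
      vaeObjective_lt_of_row hne (fun _ _ => rfl) ?_ ?_⟩
    · rw [hVi]
      exact Finset.sum_pos (fun p _ => mul_pos (hx' p) (pow_pos (hσ i p) 2))
        ⟨j, Finset.mem_univ j⟩
    · rw [hVi, ← sub_neg]
      change ∑ p, y p * σ i p ^ 2 - ∑ p, x p * σ i p ^ 2 < 0
      rw [hdiff]
      have : 0 < δ * (x j - x k) := hδD.lt_of_ne' (mul_ne_zero hδ (sub_ne_zero.mpr hD))
      have hlt : x k * (δ * (σ i j ^ 2 - σ i k ^ 2)) < 0 := by
        rw [hneg]; exact neg_neg_of_pos (mul_pos hσj this)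
      exact (pos_iff_neg_of_mul_neg hlt).mp (hx k)
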